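/- Let 0 ≤ α < 1. If f is starlike of order α on the unit disc and g is univalent on the unit disc with g(0)=0, g'(0)=1, then T_g f(z) = ∫₀^z f(s)g'(s)ds satisfies Re(1 + z(T_g f)''(z)/(T_g f)'(z)) > 0 for all |z| < (2 − √(3 + α²))/(1 − α). -/

import Mathlib

open Complex Metric

theorem det_smul_id_sub_smul_conj (a c : ℂ) :
    (a • ContinuousLinearMap.id ℝ ℂ - c • (conjCLE : ℂ →L[ℝ] ℂ)).det = ‖a‖ ^ 2 - ‖c‖ ^ 2 := by
  rw [ContinuousLinearMap.det, ← LinearMap.det_toMatrix basisOneI, Matrix.det_fin_two,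
    ← normSq_eq_norm_sq, ← normSq_eq_norm_sq, normSq_apply, normSq_apply]
  simp [LinearMap.toMatrix_apply]
  ring

theorem norm_neg_inv_sq_add_sq_ge {r : ℝ} {w : ℂ} (hw : ‖w‖ = r) (b d : ℂ) :
    (r ^ 4)⁻¹ - ‖b‖ ^ 2 +
      (2 * (starRingEnd ℂ b) * d - 2 * ((r ^ 4)⁻¹ : ℝ) * (d * w ^ 2)).re ≤
      ‖-(w ^ 2)⁻¹ + d‖ ^ 2 := by
  have hinv : (w ^ 2)⁻¹ = ((r ^ 4)⁻¹ : ℝ) * (starRingEnd ℂ w) ^ 2 := by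
    rw [inv_def, normSq_eq_norm_sq, norm_pow, hw, map_pow, mul_comm]
    congr 2; ring
  have h1 : ‖-(w ^ 2)⁻¹ + d‖ ^ 2 =
      ‖(w ^ 2)⁻¹‖ ^ 2 + ‖d‖ ^ 2 - 2 * ((r ^ 4)⁻¹ : ℝ) * (d * w ^ 2).re := by
    rw [neg_add_eq_sub, ← normSq_eq_norm_sq, normSq_sub, normSq_eq_norm_sq, normSq_eq_norm_sq, hinv]
    have : (d * (starRingEnd ℂ) (((r ^ 4)⁻¹ : ℝ) * (starRingEnd ℂ w) ^ 2)).re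
        = (r ^ 4)⁻¹ * (d * w ^ 2).re := by
      rw [← re_ofReal_mul]; congr 1
      simp only [map_mul, conj_ofReal, map_pow, conj_conj]; ring
    rw [this]; ring
  have h2 : ‖(w ^ 2)⁻¹‖ ^ 2 = (r ^ 4)⁻¹ := by
    rw [norm_inv, norm_pow, hw, inv_pow]; congr 1; ring
  have h3 : 0 ≤ ‖d - b‖ ^ 2 := by positivity
  rw [← normSq_eq_norm_sq, normSq_sub, normSq_eq_norm_sq, normSq_eq_norm_sq] at h3
  have h4 : (2 * (starRingEnd ℂ b) * d - 2 * ((r ^ 4)⁻¹ : ℝ) * (d * w ^ 2)).re =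
      2 * (d * starRingEnd ℂ b).re - 2 * (r ^ 4)⁻¹ * (d * w ^ 2).re := by
    rw [sub_re]
    congr 1
    · rw [← re_ofReal_mul]; congr 1; push_cast; ring
    · rw [← re_ofReal_mul]; congr 1; push_cast; ring
  rw [h1, h2, h4]
  linarith

theorem circleAverage_norm_neg_inv_sq_add_sq_ge {D : ℂ → ℂ} (hD : DifferentiableOn ℂ D (ball 0 1))
    {r : ℝ} (hr : 0 < r) (hr1 : r < 1) :
    (r ^ 4)⁻¹ + ‖D 0‖ ^ 2 ≤ Real.circleAverage (fun w ↦ ‖-(w ^ 2)⁻¹ + D w‖ ^ 2) 0 r := by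
  set Φ : ℂ → ℂ := fun w ↦
    ((r ^ 4)⁻¹ - ‖D 0‖ ^ 2 : ℝ) +
      (2 * (starRingEnd ℂ (D 0)) * D w - 2 * ((r ^ 4)⁻¹ : ℝ) * (D w * w ^ 2)) with hΦ
  have hΦd : DifferentiableOn ℂ Φ (ball 0 1) := by
    simp only [hΦ]; fun_prop
  have hsub : closedBall (0 : ℂ) |r| ⊆ ball 0 1 := closedBall_subset_ball (by rwa [abs_of_pos hr])
  have hsph : sphere (0 : ℂ) |r| ⊆ ball 0 1 := sphere_subset_closedBall.trans hsub
  have hΦc : CircleIntegrable Φ 0 r :=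
    (hΦd.continuousOn.mono hsph).circleIntegrable'
  have havg : Real.circleAverage (fun w ↦ (Φ w).re) 0 r = (Φ 0).re := by
    have h := (hΦd.diffContOnCl_ball hsub).circleAverage
    rw [← h]
    exact reCLM.circleAverage_comp_comm hΦc
  have h0 : (Φ 0).re = (r ^ 4)⁻¹ + ‖D 0‖ ^ 2 := by
    have : Φ 0 = ((r ^ 4)⁻¹ + ‖D 0‖ ^ 2 : ℝ) := by
      have : 2 * (starRingEnd ℂ (D 0)) * D 0 = 2 * (‖D 0‖ ^ 2 : ℝ) := by
        rw [mul_assoc, mul_comm _ (D 0), mul_conj, normSq_eq_norm_sq]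
      simp only [hΦ, this]
      push_cast; ring
    rw [this, ofReal_re]
  rw [← h0, ← havg]
  refine Real.circleAverage_mono ?_ ?_ fun w hw ↦ ?_
  · exact ContinuousOn.circleIntegrable' (continuous_re.comp_continuousOn (hΦd.continuousOn.mono hsph))
  · refine ContinuousOn.circleIntegrable' ?_
    have := hD.continuousOn.mono hsph
    have hne : ∀ w ∈ sphere (0 : ℂ) |r|, w ^ 2 ≠ 0 := by
      intro w hw
      have : w ≠ 0 := ne_of_mem_sphere hw (by positivity)
      positivity
    fun_prop (disch := assumption)
  · have hw' : ‖w‖ = r := by simpa [abs_of_pos hr] using hw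
    simp only [hΦ]
    rw [add_re, ofReal_re]
    exact norm_neg_inv_sq_add_sq_ge hw' (D 0) (D w)

theorem isPreconnected_compl_closedBall_zero {R : ℝ} (hR : 0 ≤ R) :
    IsPreconnected (closedBall (0 : ℂ) R)ᶜ := by
  have : (closedBall (0 : ℂ) R)ᶜ =
      (fun p : ℝ × ℝ ↦ (p.1 : ℂ) * exp (p.2 * I)) '' (Set.Ioi R ×ˢ Set.univ) := by
    ext z
    simp only [Set.mem_compl_iff, mem_closedBall, dist_zero_right, not_le, Set.mem_image,
      Set.mem_prod, Set.mem_Ioi, Set.mem_univ, and_true, Prod.exists]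
    constructor
    · exact fun h ↦ ⟨‖z‖, arg z, h, norm_mul_exp_arg_mul_I z⟩
    · rintro ⟨r, θ, h, rfl⟩
      rwa [norm_mul, norm_exp_ofReal_mul_I, mul_one, norm_real, Real.norm_of_nonneg (hR.trans h.le)]
  rw [this]
  exact ((convex_Ioi R).prod convex_univ).isPreconnected.image _ (by fun_prop)

open MeasureTheory in
theorem setIntegral_annulus_norm_neg_inv_sq_add_sq_ge {D : ℂ → ℂ}
    (hD : DifferentiableOn ℂ D (ball 0 1)) {ρ t : ℝ} (hρ : 0 < ρ) (hρt : ρ < t) (ht : t < 1) :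
    Real.pi * ((ρ ^ 2)⁻¹ - (t ^ 2)⁻¹ + ‖D 0‖ ^ 2 * (t ^ 2 - ρ ^ 2)) ≤
      ∫ w in {w : ℂ | ρ < ‖w‖ ∧ ‖w‖ < t}, ‖-(w ^ 2)⁻¹ + D w‖ ^ 2 := by
  set F : ℂ → ℝ := fun w ↦ ‖-(w ^ 2)⁻¹ + D w‖ ^ 2 with hF
  have hAmeas : MeasurableSet {w : ℂ | ρ < ‖w‖ ∧ ‖w‖ < t} :=
    ((isOpen_lt continuous_const continuous_norm).inter
      (isOpen_lt continuous_norm continuous_const)).measurableSet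
  have hFc : ContinuousOn F (ball 0 1 \ {0}) := by
    have := hD.continuousOn.mono (Set.sdiff_subset (s := ball (0 : ℂ) 1) (t := {0}))
    have hne : ∀ w ∈ ball (0 : ℂ) 1 \ {0}, w ^ 2 ≠ 0 := fun w hw ↦ pow_ne_zero 2 hw.2
    fun_prop (disch := assumption)
  have hcirc : ∀ r ∈ Set.Icc ρ t, ∀ θ : ℝ, circleMap 0 r θ ∈ ball (0 : ℂ) 1 \ {0} := by
    intro r hr θ
    have hr0 : 0 < r := hρ.trans_le hr.1
    have : ‖circleMap 0 r θ‖ = r := by simp [abs_of_pos hr0]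
    refine ⟨by simpa [abs_of_pos hr0] using hr.2.trans_lt ht, fun h ↦ ?_⟩
    rw [Set.mem_singleton_iff] at h
    rw [h, norm_zero] at this
    exact hr0.ne this
  have hint : IntegrableOn (fun p : ℝ × ℝ ↦ p.1 * F (circleMap 0 p.1 p.2))
      (Set.Ioo ρ t ×ˢ Set.Ioo (-Real.pi) Real.pi) (volume.prod volume) := by
    have hcont : ContinuousOn (fun p : ℝ × ℝ ↦ p.1 * F (circleMap 0 p.1 p.2))
        (Set.Icc ρ t ×ˢ Set.Icc (-Real.pi) Real.pi) := by
      refine continuousOn_fst.mul (hFc.comp ?_ fun p hp ↦ hcirc p.1 hp.1 p.2)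
      unfold circleMap
      fun_prop
    exact (hcont.integrableOn_compact (isCompact_Icc.prod isCompact_Icc)).mono_set
      (Set.prod_mono Set.Ioo_subset_Icc_self Set.Ioo_subset_Icc_self)
  have hpolar : ∫ w in {w : ℂ | ρ < ‖w‖ ∧ ‖w‖ < t}, F w =
      ∫ r in Set.Ioo ρ t, ∫ θ in Set.Ioo (-Real.pi) Real.pi, r * F (circleMap 0 r θ) := by
    rw [← integral_indicator hAmeas, ← Complex.integral_comp_polarCoord_symm,
      ← setIntegral_prod _ hint, ← Measure.volume_eq_prod]
    have hsub : Set.Ioo ρ t ×ˢ Set.Ioo (-Real.pi) Real.pi ⊆ polarCoord.target :=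
      Set.prod_mono (fun r hr ↦ hρ.trans hr.1) subset_rfl
    refine (setIntegral_eq_of_subset_of_forall_sdiff_eq_zero
      _root_.polarCoord.open_target.measurableSet hsub ?_).trans ?_
    · rintro p ⟨hp, hp'⟩
      rw [Set.indicator_of_notMem, smul_zero]
      rw [Set.mem_ofPred_eq, Complex.norm_polarCoord_symm, abs_of_pos hp.1]
      exact fun h ↦ hp' ⟨h, hp.2⟩
    · refine setIntegral_congr_fun (measurableSet_Ioo.prod measurableSet_Ioo) fun p hp ↦ ?_
      have h1 : Complex.polarCoord.symm p = circleMap 0 p.1 p.2 := by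
        rw [Complex.polarCoord_symm_apply, circleMap, zero_add, exp_mul_I, ofReal_cos, ofReal_sin]
      have h2 : ‖circleMap 0 p.1 p.2‖ = p.1 := by simp [(hρ.trans hp.1.1).le]
      have h3 : circleMap 0 p.1 p.2 ∈ {w : ℂ | ρ < ‖w‖ ∧ ‖w‖ < t} := by
        rw [Set.mem_ofPred_eq, h2]; exact hp.1
      simp only [h1, Set.indicator_of_mem h3, smul_eq_mul]
  have hinner : ∀ r ∈ Set.Ioo ρ t, 2 * Real.pi * (r ^ (-3 : ℤ) + ‖D 0‖ ^ 2 * r) ≤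
      ∫ θ in Set.Ioo (-Real.pi) Real.pi, r * F (circleMap 0 r θ) := by
    intro r hr
    have hr0 : 0 < r := hρ.trans hr.1
    have h := circleAverage_norm_neg_inv_sq_add_sq_ge hD hr0 (hr.2.trans ht)
    rw [Real.circleAverage_eq_integral_add (-Real.pi),
      intervalIntegral.integral_comp_add_right (fun θ ↦ F (circleMap 0 r θ)),
      zero_add, show 2 * Real.pi + -Real.pi = Real.pi by ring,
      intervalIntegral.integral_of_le (by linarith [Real.pi_pos]), integral_Ioc_eq_integral_Ioo,
      smul_eq_mul, inv_mul_eq_div, le_div_iff₀ (by positivity)] at h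
    rw [integral_const_mul]
    calc 2 * Real.pi * (r ^ (-3 : ℤ) + ‖D 0‖ ^ 2 * r)
        = r * (((r ^ 4)⁻¹ + ‖D 0‖ ^ 2) * (2 * Real.pi)) := by
          rw [zpow_neg]; norm_cast; field_simp
      _ ≤ _ := by gcongr
  have hcompute : ∫ r in Set.Ioo ρ t, 2 * Real.pi * (r ^ (-3 : ℤ) + ‖D 0‖ ^ 2 * r) =
      Real.pi * ((ρ ^ 2)⁻¹ - (t ^ 2)⁻¹ + ‖D 0‖ ^ 2 * (t ^ 2 - ρ ^ 2)) := by
    have h0 : (0 : ℝ) ∉ Set.uIcc ρ t := by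
      rw [Set.uIcc_of_le hρt.le]; exact fun h ↦ hρ.not_ge h.1
    have hlin : IntervalIntegrable (fun r : ℝ ↦ ‖D 0‖ ^ 2 * r) volume ρ t :=
      Continuous.intervalIntegrable (by fun_prop) _ _
    rw [← integral_Ioc_eq_integral_Ioo, ← intervalIntegral.integral_of_le hρt.le,
      intervalIntegral.integral_const_mul, intervalIntegral.integral_add
        (intervalIntegral.intervalIntegrable_zpow (Or.inr h0)) hlin,
      intervalIntegral.integral_const_mul, integral_zpow (Or.inr ⟨by norm_num, h0⟩), integral_id]
    rw [show (-3 : ℤ) + 1 = -(2 : ℕ) by norm_num, zpow_neg, zpow_neg, zpow_natCast, zpow_natCast]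
    push_cast
    have := hρ.trans hρt
    field_simp
    ring
  rw [hpolar, ← hcompute]
  refine setIntegral_mono_on ?_ ?_ measurableSet_Ioo hinner
  · have : ContinuousOn (fun r : ℝ ↦ 2 * Real.pi * (r ^ (-3 : ℤ) + ‖D 0‖ ^ 2 * r))
        (Set.Icc ρ t) := by
      have h0 : ∀ r ∈ Set.Icc ρ t, r ≠ 0 ∨ (0 : ℤ) ≤ -3 := fun r hr ↦ Or.inl (hρ.trans_le hr.1).ne'
      fun_prop (disch := assumption)
    exact (this.integrableOn_compact isCompact_Icc).mono_set Set.Ioo_subset_Icc_self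
  · rw [IntegrableOn, ← Measure.prod_restrict] at hint
    exact hint.integral_prod_left

/-- The real-linear map `ζ ↦ ζ - c * conj ζ` is a homeomorphism of the plane when `‖c‖ ≠ 1`. -/
noncomputable def subMulConjHomeomorph (c : ℂ) (hc : ‖c‖ ≠ 1) : ℂ ≃ₜ ℂ where
  toFun ζ := ζ - c * starRingEnd ℂ ζ
  invFun ζ := (1 - ‖c‖ ^ 2 : ℝ)⁻¹ * (ζ + c * starRingEnd ℂ ζ)
  left_inv ζ := by
    have h : ((1 - ‖c‖ ^ 2 : ℝ) : ℂ) ≠ 0 := by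
      rw [ofReal_ne_zero, sub_ne_zero]
      exact fun h ↦ hc ((pow_eq_one_iff_of_nonneg (norm_nonneg c) two_ne_zero).1 h.symm)
    rw [ofReal_inv, inv_mul_eq_iff_eq_mul₀ h]
    have h2 := mul_conj c
    rw [normSq_eq_norm_sq] at h2
    push_cast at h2 ⊢
    rw [← h2]
    simp only [map_sub, map_mul, conj_conj]
    ring
  right_inv ζ := by
    have h : ((1 - ‖c‖ ^ 2 : ℝ) : ℂ) ≠ 0 := by
      rw [ofReal_ne_zero, sub_ne_zero]
      exact fun h ↦ hc ((pow_eq_one_iff_of_nonneg (norm_nonneg c) two_ne_zero).1 h.symm)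
    have h2 := mul_conj c
    rw [normSq_eq_norm_sq] at h2
    simp only [map_mul, conj_ofReal, map_add, conj_conj]
    rw [mul_left_comm, ← mul_sub, ofReal_inv, inv_mul_eq_iff_eq_mul₀ h]
    push_cast at h2 ⊢
    rw [← h2]
    ring
  continuous_toFun := by fun_prop
  continuous_invFun := by fun_prop

theorem AnalyticOnNhd.isOpen_image_of_injOn {G : ℂ → ℂ} {U : Set ℂ} (hG : AnalyticOnNhd ℂ G U)
    (hU : IsOpen U) (hinj : Set.InjOn G U) : IsOpen (G '' U) := by
  refine isOpen_iff_mem_nhds.2 ?_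
  rintro _ ⟨z, hz, rfl⟩
  rcases (hG z hz).eventually_constant_or_nhds_le_map_nhds with h | h
  · exfalso
    have h1 : ∀ᶠ w in nhdsWithin z {z}ᶜ, False := by
      filter_upwards [nhdsWithin_le_nhds h, nhdsWithin_le_nhds (hU.mem_nhds hz),
        self_mem_nhdsWithin] with w hw hwU hne
      exact hne (hinj hwU hz hw)
    exact h1.exists.choose_spec
  · exact h (Filter.image_mem_map (hU.mem_nhds hz))

/-- If `M` has a pole-like behaviour at `0`, is open on the punctured disc and is bounded by `R`
on its boundary circle, then the image of the punctured disc covers the exterior of the disc of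
radius `R`. -/
theorem compl_closedBall_subset_image_punctured_ball {M : ℂ → ℂ} {ρ R : ℝ} (hρ : 0 < ρ) (hR : 0 ≤ R)
    (hopen : IsOpen (M '' (ball 0 ρ \ {0})))
    (hcont : ContinuousOn M (closedBall 0 ρ \ {0}))
    (hbd : ∀ w, ‖w‖ = ρ → ‖M w‖ ≤ R)
    (hpole : Filter.Tendsto (fun w ↦ ‖M w‖) (nhdsWithin 0 {0}ᶜ) Filter.atTop) :
    (closedBall (0 : ℂ) R)ᶜ ⊆ M '' (ball 0 ρ \ {0}) := by
  refine (isPreconnected_compl_closedBall_zero hR).subset_of_closure_inter_subset hopen ?_ ?_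
  · have h1 := hpole.eventually_gt_atTop R
    have h2 : ∀ᶠ w in nhdsWithin (0 : ℂ) {0}ᶜ, w ∈ ball (0 : ℂ) ρ :=
      nhdsWithin_le_nhds (ball_mem_nhds 0 hρ)
    obtain ⟨w, hw1, hw2, hw3⟩ := (h1.and (h2.and self_mem_nhdsWithin)).exists
    exact ⟨M w, by simpa using hw1, w, ⟨hw2, hw3⟩, rfl⟩
  · rintro ζ ⟨hζ, hζR⟩
    have h1 := hpole.eventually_gt_atTop (‖ζ‖ + 1)
    rw [eventually_nhdsWithin_iff, Metric.eventually_nhds_iff] at h1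
    obtain ⟨δ, hδ, h1⟩ := h1
    have hK : IsCompact (M '' (closedBall 0 ρ \ ball 0 δ)) := by
      refine ((isCompact_closedBall (0 : ℂ) ρ).diff isOpen_ball).image_of_continuousOn (hcont.mono ?_)
      refine Set.sdiff_subset_sdiff_right ?_
      rintro _ rfl
      exact mem_ball_self hδ
    have hmem : ζ ∈ M '' (closedBall 0 ρ \ ball 0 δ) := by
      rw [← hK.isClosed.closure_eq, mem_closure_iff_nhds]
      intro V hV
      obtain ⟨_, ⟨hηV, hηB⟩, w, hw, rfl⟩ :=
        mem_closure_iff_nhds.1 hζ _ (Filter.inter_mem hV (ball_mem_nhds ζ one_pos))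
      refine ⟨M w, hηV, w, ⟨ball_subset_closedBall hw.1, fun hwδ ↦ ?_⟩, rfl⟩
      have h3 := h1 hwδ hw.2
      have h4 : ‖M w - ζ‖ < 1 := by rwa [← dist_eq_norm]
      linarith [norm_le_norm_add_norm_sub ζ (M w), norm_sub_rev ζ (M w)]
    obtain ⟨w, ⟨hw1, hw2⟩, rfl⟩ := hmem
    refine ⟨w, ⟨?_, ?_⟩, rfl⟩
    · rw [mem_closedBall_zero_iff] at hw1
      rw [mem_ball_zero_iff]
      refine lt_of_le_of_ne hw1 fun h ↦ hζR ?_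
      simpa using hbd w h
    · rintro rfl
      exact hw2 (mem_ball_self hδ)

theorem hasFDerivAt_sub_mul_conj {G : ℂ → ℂ} {G' w : ℂ} (c : ℂ) (hG : HasDerivAt G G' w) :
    HasFDerivAt (fun z ↦ G z - c * starRingEnd ℂ (G z))
      (G' • ContinuousLinearMap.id ℝ ℂ - (c * starRingEnd ℂ G') • (conjCLE : ℂ →L[ℝ] ℂ)) w := by
  have h1 : HasFDerivAt G (G' • ContinuousLinearMap.id ℝ ℂ) w := hG.complexToReal_fderiv
  have h2 := (conjCLE.toContinuousLinearMap.hasFDerivAt (x := G w)).comp w h1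
  refine (h1.sub (h2.const_mul c)).congr_fderiv ?_
  ext
  simp [mul_assoc]

/-- If `M = G - c * conj G` maps the annulus `ρ < ‖w‖ < t` injectively into the disc of radius `R`,
where `G' = -w⁻² + D`, then comparing areas gives an upper bound on the size of `D 0`. -/
theorem area_inequality_of_mapsTo {G D : ℂ → ℂ} {c : ℂ} {ρ t R : ℝ}
    (hD : DifferentiableOn ℂ D (ball 0 1)) (hc : ‖c‖ ≤ 1) (hρ : 0 < ρ) (hρt : ρ < t) (ht : t < 1)
    (hG : ∀ w, ρ < ‖w‖ → ‖w‖ < t → HasDerivAt G (-(w ^ 2)⁻¹ + D w) w)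
    (hR : 0 ≤ R)
    (hinj : Set.InjOn (fun w ↦ G w - c * starRingEnd ℂ (G w)) {w | ρ < ‖w‖ ∧ ‖w‖ < t})
    (hmaps : Set.MapsTo (fun w ↦ G w - c * starRingEnd ℂ (G w)) {w | ρ < ‖w‖ ∧ ‖w‖ < t}
      (closedBall 0 R)) :
    (1 - ‖c‖ ^ 2) * ((ρ ^ 2)⁻¹ - (t ^ 2)⁻¹ + ‖D 0‖ ^ 2 * (t ^ 2 - ρ ^ 2)) ≤ R ^ 2 := by
  set A : Set ℂ := {w | ρ < ‖w‖ ∧ ‖w‖ < t} with hA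
  set M : ℂ → ℂ := fun w ↦ G w - c * starRingEnd ℂ (G w) with hM
  have hAmeas : MeasurableSet A :=
    ((isOpen_lt continuous_const continuous_norm).inter
      (isOpen_lt continuous_norm continuous_const)).measurableSet
  have hc2 : 0 ≤ 1 - ‖c‖ ^ 2 := by nlinarith [norm_nonneg c]
  have hcv := MeasureTheory.integral_image_eq_integral_abs_det_fderiv_smul MeasureTheory.volume
    hAmeas (fun w hw ↦ (hasFDerivAt_sub_mul_conj c (hG w hw.1 hw.2)).hasFDerivWithinAt) hinj
    (fun _ ↦ (1 : ℝ))
  have hdet : ∀ w, |(((-(w ^ 2)⁻¹ + D w) • ContinuousLinearMap.id ℝ ℂ -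
      (c * starRingEnd ℂ (-(w ^ 2)⁻¹ + D w)) • (conjCLE : ℂ →L[ℝ] ℂ)).det)| • (1 : ℝ) =
      (1 - ‖c‖ ^ 2) * ‖-(w ^ 2)⁻¹ + D w‖ ^ 2 := by
    intro w
    rw [det_smul_id_sub_smul_conj, norm_mul, norm_conj, smul_eq_mul, mul_one]
    rw [show ∀ x y : ℝ, x ^ 2 - (y * x) ^ 2 = (1 - y ^ 2) * x ^ 2 by intros; ring]
    exact abs_of_nonneg (by positivity)
  simp only [hdet] at hcv
  rw [MeasureTheory.integral_const_mul, MeasureTheory.setIntegral_const, smul_eq_mul, mul_one] at hcv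
  have hvol : MeasureTheory.volume.real (M '' A) ≤ R ^ 2 * Real.pi := by
    refine (MeasureTheory.measureReal_mono hmaps.image_subset
      MeasureTheory.measure_closedBall_lt_top.ne).trans_eq ?_
    rw [MeasureTheory.Measure.real, Complex.volume_closedBall]
    simp [ENNReal.toReal_ofReal hR]
  have hlow := mul_le_mul_of_nonneg_left
    (setIntegral_annulus_norm_neg_inv_sq_add_sq_ge hD hρ hρt ht) hc2
  rw [← hcv] at hlow
  refine le_of_mul_le_mul_right ?_ Real.pi_pos
  linarith

theorem norm_sub_mul_conj_le_on_circle {b q w : ℂ} {ρ K : ℝ} (hρ : 0 < ρ) (hρ1 : ρ ≤ 1)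
    (hw : ‖w‖ = ρ) (hq : ‖q‖ ≤ K) :
    ‖(w⁻¹ + (b * w + w ^ 3 * q)) -
      b * (ρ ^ 2 : ℝ) * starRingEnd ℂ (w⁻¹ + (b * w + w ^ 3 * q))‖ ≤
      ρ⁻¹ + (‖b‖ ^ 2 + K + ‖b‖ * K) * ρ ^ 3 := by
  have hw0 : w ≠ 0 := by rw [← norm_pos_iff, hw]; exact hρ
  have hconj : ((ρ ^ 2 : ℝ) : ℂ) * starRingEnd ℂ w⁻¹ = w := by
    rw [← hw, ← normSq_eq_norm_sq, ← mul_conj, map_inv₀]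
    have : starRingEnd ℂ w ≠ 0 := by simpa using hw0
    field_simp
  have heq : (w⁻¹ + (b * w + w ^ 3 * q)) -
      b * (ρ ^ 2 : ℝ) * starRingEnd ℂ (w⁻¹ + (b * w + w ^ 3 * q)) =
      w⁻¹ - b * (ρ ^ 2 : ℝ) * starRingEnd ℂ (b * w) + w ^ 3 * q -
        b * (ρ ^ 2 : ℝ) * starRingEnd ℂ (w ^ 3 * q) := by
    rw [map_add, map_add, mul_add, mul_assoc b, hconj]
    ring
  have hK : 0 ≤ K := (norm_nonneg q).trans hq
  have h1 : ‖b * (ρ ^ 2 : ℝ) * starRingEnd ℂ (b * w)‖ = ‖b‖ ^ 2 * ρ ^ 3 := by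
    rw [norm_mul, norm_mul, norm_conj, norm_mul, norm_real, Real.norm_of_nonneg (by positivity), hw]
    ring
  have h2 : ‖w ^ 3 * q‖ ≤ ρ ^ 3 * K := by
    rw [norm_mul, norm_pow, hw]; gcongr
  have h3 : ‖b * (ρ ^ 2 : ℝ) * starRingEnd ℂ (w ^ 3 * q)‖ ≤ ‖b‖ * K * ρ ^ 3 := by
    rw [norm_mul, norm_mul, norm_conj, norm_real, Real.norm_of_nonneg (by positivity)]
    calc ‖b‖ * ρ ^ 2 * ‖w ^ 3 * q‖ ≤ ‖b‖ * 1 * (ρ ^ 3 * K) := by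
          gcongr; exact pow_le_one₀ hρ.le hρ1
      _ = _ := by ring
  rw [heq]
  calc _ ≤ ‖w⁻¹‖ + ‖b * (ρ ^ 2 : ℝ) * starRingEnd ℂ (b * w)‖ + ‖w ^ 3 * q‖ +
        ‖b * (ρ ^ 2 : ℝ) * starRingEnd ℂ (w ^ 3 * q)‖ :=
        (norm_sub_le _ _).trans (add_le_add_left ((norm_add_le _ _).trans
          (add_le_add_left (norm_sub_le _ _) _)) _)
    _ ≤ _ := by rw [norm_inv, hw, h1]; linarith

theorem tendsto_norm_sub_mul_conj_atTop {H : ℂ → ℂ} {c : ℂ} (hH : ContinuousAt H 0)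
    (hc : ‖c‖ < 1) :
    Filter.Tendsto (fun w ↦ ‖(w⁻¹ + H w) - c * starRingEnd ℂ (w⁻¹ + H w)‖)
      (nhdsWithin 0 {0}ᶜ) Filter.atTop := by
  have h1 : Filter.Tendsto (fun w : ℂ ↦ ‖w⁻¹‖) (nhdsWithin 0 {0}ᶜ) Filter.atTop :=
    tendsto_norm_cobounded_atTop.comp Filter.tendsto_inv₀_nhdsNE_zero
  have h2 : Filter.Tendsto (fun w ↦ -‖H w‖) (nhdsWithin 0 {0}ᶜ) (nhds (-‖H 0‖)) :=
    (hH.norm.neg).tendsto.mono_left nhdsWithin_le_nhds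
  refine Filter.tendsto_atTop_mono (fun w ↦ ?_)
    ((h1.atTop_add h2).const_mul_atTop (sub_pos.2 hc))
  have h3 : ‖w⁻¹‖ - ‖H w‖ ≤ ‖w⁻¹ + H w‖ := by
    have := norm_sub_le (w⁻¹ + H w) (H w)
    rw [add_sub_cancel_right] at this
    linarith
  have h4 : ‖w⁻¹ + H w‖ - ‖c‖ * ‖w⁻¹ + H w‖ ≤
      ‖(w⁻¹ + H w) - c * starRingEnd ℂ (w⁻¹ + H w)‖ := by
    have := norm_sub_norm_le (w⁻¹ + H w) (c * starRingEnd ℂ (w⁻¹ + H w))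
    rwa [norm_mul, norm_conj] at this
  nlinarith

/-- **Area theorem** (Gronwall), for the coefficient of `w`: if `w⁻¹ + b w + O(w³)` is injective
on the punctured unit disc, then `‖b‖ ≤ 1`. -/
theorem norm_le_one_of_injOn_inv_add {b : ℂ} {Q : ℂ → ℂ} (hQ : DifferentiableOn ℂ Q (ball 0 1))
    (hinj : Set.InjOn (fun w ↦ w⁻¹ + (b * w + w ^ 3 * Q w)) (ball 0 1 \ {0})) : ‖b‖ ≤ 1 := by
  set H : ℂ → ℂ := fun w ↦ b * w + w ^ 3 * Q w with hHdef
  set G : ℂ → ℂ := fun w ↦ w⁻¹ + H w with hGdef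
  have hH : DifferentiableOn ℂ H (ball 0 1) := by
    simp only [hHdef]; fun_prop
  have hD : DifferentiableOn ℂ (deriv H) (ball 0 1) := hH.deriv isOpen_ball
  have hHat : ∀ w ∈ ball (0 : ℂ) 1, DifferentiableAt ℂ H w := fun w hw ↦
    hH.differentiableAt (isOpen_ball.mem_nhds hw)
  have hD0 : deriv H 0 = b := by
    have hQ0 := (hQ.differentiableAt (ball_mem_nhds 0 one_pos)).hasDerivAt
    have : HasDerivAt H _ 0 :=
      ((hasDerivAt_id (0 : ℂ)).const_mul b).add ((hasDerivAt_pow 3 (0 : ℂ)).mul hQ0)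
    simpa using this.deriv
  have hGderiv : ∀ w ∈ ball (0 : ℂ) 1 \ {0}, HasDerivAt G (-(w ^ 2)⁻¹ + deriv H w) w :=
    fun w hw ↦ (hasDerivAt_inv hw.2).add (hHat w hw.1).hasDerivAt
  have hopenB : IsOpen (ball (0 : ℂ) 1 \ {0}) := isOpen_ball.sdiff isClosed_singleton
  have hGan : AnalyticOnNhd ℂ G (ball 0 1 \ {0}) :=
    DifferentiableOn.analyticOnNhd
      (fun w hw ↦ (hGderiv w hw).differentiableAt.differentiableWithinAt) hopenB
  obtain ⟨K, hK⟩ := (isCompact_closedBall (0 : ℂ) (1 / 2)).exists_bound_of_continuousOn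
    (hQ.continuousOn.mono (closedBall_subset_ball (by norm_num)))
  set C : ℝ := ‖b‖ ^ 2 + K + ‖b‖ * K with hC
  have hK0 : 0 ≤ K := (norm_nonneg _).trans (hK 0 (by simp))
  have key : ∀ ρ t : ℝ, 0 < ρ → ρ ≤ 1 / 2 → ‖b‖ * ρ ^ 2 < 1 → ρ < t → t < 1 →
      (1 - (‖b‖ * ρ ^ 2) ^ 2) * ((ρ ^ 2)⁻¹ - (t ^ 2)⁻¹ + ‖b‖ ^ 2 * (t ^ 2 - ρ ^ 2)) ≤
        (ρ⁻¹ + C * ρ ^ 3) ^ 2 := by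
    intro ρ t hρ hρ2 hbρ hρt ht
    have hcn : ‖b * (ρ ^ 2 : ℝ)‖ = ‖b‖ * ρ ^ 2 := by
      rw [norm_mul, norm_real, Real.norm_of_nonneg (by positivity)]
    have hc1 : ‖b * (ρ ^ 2 : ℝ)‖ < 1 := hcn ▸ hbρ
    set L := subMulConjHomeomorph (b * (ρ ^ 2 : ℝ)) hc1.ne with hL
    have hLG : ∀ w, L (G w) = G w - b * (ρ ^ 2 : ℝ) * starRingEnd ℂ (G w) := fun w ↦ rfl
    have hsub : ball (0 : ℂ) ρ \ {0} ⊆ ball 0 1 \ {0} :=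
      Set.sdiff_subset_sdiff_left (ball_subset_ball (by linarith))
    have hAsub : {w : ℂ | ρ < ‖w‖ ∧ ‖w‖ < t} ⊆ ball 0 1 \ {0} := fun w hw ↦
      ⟨mem_ball_zero_iff.2 (hw.2.trans ht), norm_pos_iff.1 (hρ.trans hw.1)⟩
    have hLinj : Set.InjOn (fun w ↦ L (G w)) (ball 0 1 \ {0}) :=
      L.injective.comp_injOn hinj
    have hR : 0 ≤ ρ⁻¹ + C * ρ ^ 3 := by positivity
    have hcover := compl_closedBall_subset_image_punctured_ball (M := fun w ↦ L (G w)) hρ hR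
      (by
        rw [← Set.image_image L G]
        exact L.isOpenMap _ ((hGan.mono hsub).isOpen_image_of_injOn
          (isOpen_ball.sdiff isClosed_singleton) (hinj.mono hsub)))
      (L.continuous.comp_continuousOn (hGan.continuousOn.mono
        (Set.sdiff_subset_sdiff_left (closedBall_subset_ball (by linarith)))))
      (fun w hw ↦ norm_sub_mul_conj_le_on_circle hρ (by linarith) hw
        (hK w (mem_closedBall_zero_iff.2 (hw.trans_le hρ2))))
      (tendsto_norm_sub_mul_conj_atTop (hHat 0 (mem_ball_self one_pos)).continuousAt hc1)
    have hmaps : Set.MapsTo (fun w ↦ L (G w)) {w | ρ < ‖w‖ ∧ ‖w‖ < t}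
        (closedBall 0 (ρ⁻¹ + C * ρ ^ 3)) := by
      intro w hw
      by_contra h
      obtain ⟨w', hw', heq⟩ := hcover h
      have := hLinj (hsub hw') (hAsub hw) heq
      exact lt_asymm hw.1 (this ▸ mem_ball_zero_iff.1 hw'.1)
    have := area_inequality_of_mapsTo hD hc1.le hρ hρt ht
      (fun w h1 h2 ↦ hGderiv w (hAsub ⟨h1, h2⟩)) hR (hLinj.mono hAsub) hmaps
    rwa [hcn, hD0] at this
  have key2 : ∀ t : ℝ, 0 < t → t < 1 → ‖b‖ ^ 2 * t ^ 2 - (t ^ 2)⁻¹ ≤ 0 := by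
    intro t ht0 ht
    set E : ℝ → ℝ := fun ρ ↦ ‖b‖ ^ 2 * (t ^ 2 - ρ ^ 2) - (t ^ 2)⁻¹ - ‖b‖ ^ 2 * ρ ^ 2 -
      ‖b‖ ^ 2 * ρ ^ 4 * (‖b‖ ^ 2 * (t ^ 2 - ρ ^ 2) - (t ^ 2)⁻¹) - 2 * C * ρ ^ 2 -
        C ^ 2 * ρ ^ 6 with hE
    have hEc : Filter.Tendsto E (nhdsWithin 0 (Set.Ioi 0)) (nhds (E 0)) :=
      (show Continuous E by simp only [hE]; fun_prop).continuousAt.tendsto.mono_left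
        nhdsWithin_le_nhds
    have hE0 : E 0 = ‖b‖ ^ 2 * t ^ 2 - (t ^ 2)⁻¹ := by simp [hE]
    rw [← hE0]
    refine le_of_tendsto hEc ?_
    have h1 : ∀ᶠ ρ : ℝ in nhdsWithin 0 (Set.Ioi 0), ρ < 1 / 2 :=
      nhdsWithin_le_nhds (eventually_lt_nhds (by norm_num))
    have h2 : ∀ᶠ ρ : ℝ in nhdsWithin 0 (Set.Ioi 0), ρ < t :=
      nhdsWithin_le_nhds (eventually_lt_nhds ht0)
    have h3 : ∀ᶠ ρ : ℝ in nhdsWithin 0 (Set.Ioi 0), ‖b‖ * ρ ^ 2 < 1 :=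
      nhdsWithin_le_nhds ((show Continuous fun ρ : ℝ ↦ ‖b‖ * ρ ^ 2 by
        fun_prop).continuousAt.eventually_lt_const (by simp))
    filter_upwards [h1, h2, h3, self_mem_nhdsWithin] with ρ h1 h2 h3 hρ
    have hρ : 0 < ρ := hρ
    have h := key ρ t hρ h1.le h3 h2 ht
    have hEq : E ρ = (1 - (‖b‖ * ρ ^ 2) ^ 2) *
        ((ρ ^ 2)⁻¹ - (t ^ 2)⁻¹ + ‖b‖ ^ 2 * (t ^ 2 - ρ ^ 2)) - (ρ⁻¹ + C * ρ ^ 3) ^ 2 := by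
      simp only [hE]
      field_simp
      ring
    rw [hEq]
    linarith
  have hlim : ‖b‖ ^ 2 * 1 ^ 2 - (1 ^ 2)⁻¹ ≤ 0 := by
    have hc : ContinuousAt (fun t : ℝ ↦ ‖b‖ ^ 2 * t ^ 2 - (t ^ 2)⁻¹) 1 := by
      fun_prop (disch := norm_num)
    refine le_of_tendsto (hc.tendsto.mono_left (nhdsWithin_le_nhds (s := Set.Iio 1))) ?_
    filter_upwards [self_mem_nhdsWithin, nhdsWithin_le_nhds (eventually_gt_nhds one_pos)]
      with t h1 h2 using key2 t h2 h1
  nlinarith [norm_nonneg b]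

theorem exists_sq_mul_eq_one {φ : ℂ → ℂ} (hφ : DifferentiableOn ℂ φ (ball 0 1))
    (hne : ∀ z ∈ ball (0 : ℂ) 1, φ z ≠ 0) (h0 : φ 0 = 1) :
    ∃ s : ℂ → ℂ, DifferentiableOn ℂ s (ball 0 1) ∧ s 0 = 1 ∧
      ∀ z ∈ ball (0 : ℂ) 1, φ z * s z ^ 2 = 1 := by
  obtain ⟨P, hP⟩ := ((hφ.deriv isOpen_ball).div hφ hne).isExactOn_ball
  set s : ℂ → ℂ := fun z ↦ exp (-(P z - P 0) / 2) with hs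
  have hsd : ∀ z ∈ ball (0 : ℂ) 1,
      HasDerivAt s (s z * (-(deriv φ z / φ z) / 2)) z := fun z hz ↦
    (((hP z hz).sub_const (P 0)).neg.div_const 2).cexp
  have hs0 : s 0 = 1 := by simp [hs]
  have hd : ∀ z ∈ ball (0 : ℂ) 1, HasDerivAt (fun z ↦ φ z * s z ^ 2) 0 z := by
    intro z hz
    have h1 := (hφ.differentiableAt (isOpen_ball.mem_nhds hz)).hasDerivAt
    refine (h1.mul ((hsd z hz).pow 2)).congr_deriv ?_
    have := hne z hz
    field_simp
    simp
    right
    ring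
  refine ⟨s, fun z hz ↦ (hsd z hz).differentiableAt.differentiableWithinAt, hs0, fun z hz ↦ ?_⟩
  have hconst := isOpen_ball.is_const_of_deriv_eq_zero (convex_ball (0 : ℂ) 1).isPreconnected
    (fun z hz ↦ (hd z hz).differentiableAt.differentiableWithinAt) (fun z hz ↦ (hd z hz).deriv)
    hz (mem_ball_self one_pos)
  simpa [h0, hs0] using hconst

/-- **Bieberbach's theorem** on the second coefficient of a normalised univalent function. -/
theorem norm_deriv_deriv_zero_le_four {h : ℂ → ℂ} (hd : DifferentiableOn ℂ h (ball 0 1))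
    (hinj : Set.InjOn h (ball 0 1)) (h0 : h 0 = 0) (h1 : deriv h 0 = 1) :
    ‖deriv (deriv h) 0‖ ≤ 4 := by
  have hB : ball (0 : ℂ) 1 ∈ nhds 0 := ball_mem_nhds 0 one_pos
  have h00 : (0 : ℂ) ∈ ball (0 : ℂ) 1 := mem_ball_self one_pos
  set φ := dslope h 0 with hφdef
  have hφ : DifferentiableOn ℂ φ (ball 0 1) := (differentiableOn_dslope hB).2 hd
  have hhφ : ∀ u, h u = u * φ u := fun u ↦ by simpa [h0] using (sub_smul_dslope h 0 u).symm
  have hφ0 : φ 0 = 1 := by rw [hφdef, dslope_same, h1]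
  have hφne : ∀ z ∈ ball (0 : ℂ) 1, φ z ≠ 0 := by
    intro z hz hz0
    have : z = 0 := hinj hz h00 (by rw [hhφ z, hz0, h0, mul_zero])
    rw [this, hφ0] at hz0
    exact one_ne_zero hz0
  obtain ⟨s, hs, hs0, hsφ⟩ := exists_sq_mul_eq_one hφ hφne hφ0
  set q := dslope (dslope s 0) 0 with hqdef
  have hq : DifferentiableOn ℂ q (ball 0 1) :=
    (differentiableOn_dslope hB).2 ((differentiableOn_dslope hB).2 hs)
  have hsq : ∀ u, s u = 1 + u * (deriv s 0 + u * q u) := by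
    intro u
    have e1 := sub_smul_dslope s 0 u
    have e2 := sub_smul_dslope (dslope s 0) 0 u
    rw [dslope_same] at e2
    simp only [sub_zero, smul_eq_mul, hs0] at e1 e2
    rw [hqdef, e2, add_sub_cancel, e1, add_sub_cancel]
  have hsqmem : ∀ w ∈ ball (0 : ℂ) 1, w ^ 2 ∈ ball (0 : ℂ) 1 := by
    intro w hw
    rw [mem_ball_zero_iff] at hw ⊢
    rw [norm_pow]
    exact pow_lt_one₀ (norm_nonneg _) hw two_ne_zero
  have hG : ∀ w ∈ ball (0 : ℂ) 1 \ {0},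
      w⁻¹ + (deriv s 0 * w + w ^ 3 * q (w ^ 2)) = w⁻¹ * s (w ^ 2) := by
    intro w hw
    have : w ≠ 0 := hw.2
    rw [hsq (w ^ 2)]
    field_simp
  have hinv : ∀ w ∈ ball (0 : ℂ) 1 \ {0}, h (w ^ 2) * (w⁻¹ * s (w ^ 2)) ^ 2 = 1 := by
    intro w hw
    have : w ≠ 0 := hw.2
    rw [← hsφ _ (hsqmem w hw.1), hhφ]
    field_simp
  have hinjG : Set.InjOn (fun w ↦ w⁻¹ + (deriv s 0 * w + w ^ 3 * q (w ^ 2)))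
      (ball 0 1 \ {0}) := by
    intro w hw w' hw' heq
    simp only [hG w hw, hG w' hw'] at heq
    have e1 := hinv w hw
    have hne : w⁻¹ * s (w ^ 2) ≠ 0 := fun h ↦ by simp [h] at e1
    have e2 : h (w ^ 2) = h (w' ^ 2) :=
      mul_right_cancel₀ (pow_ne_zero 2 hne) (by rw [e1, heq, hinv w' hw'])
    rcases sq_eq_sq_iff_eq_or_eq_neg.1 (hinj (hsqmem w hw.1) (hsqmem w' hw'.1) e2) with h | h
    · exact h
    · rw [h, neg_sq, inv_neg, neg_mul, neg_eq_self] at heq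
      rw [h, neg_sq, inv_neg, neg_mul, heq, neg_zero] at hne
      exact absurd rfl hne
  have hb := norm_le_one_of_injOn_inv_add
    (Q := fun w ↦ q (w ^ 2)) (hq.comp (by fun_prop) hsqmem) hinjG
  have hderiv : deriv φ 0 + 2 * deriv s 0 = 0 := by
    have e1 := (hφ.differentiableAt hB).hasDerivAt.mul ((hs.differentiableAt hB).hasDerivAt.pow 2)
    have e2 : HasDerivAt (φ * s ^ 2) 0 0 :=
      (hasDerivAt_const (0 : ℂ) (1 : ℂ)).congr_of_eventuallyEq
        (Filter.eventually_of_mem hB fun z hz ↦ hsφ z hz)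
    simpa [hφ0, hs0] using e1.unique e2
  have hdd : deriv (deriv h) 0 = 2 * deriv φ 0 := by
    have e1 : deriv h =ᶠ[nhds 0] fun u ↦ φ u + u * deriv φ u := by
      refine Filter.eventually_of_mem hB fun u hu ↦ ?_
      have : HasDerivAt (fun x ↦ x * φ x) (1 * φ u + u * deriv φ u) u :=
        (hasDerivAt_id u).mul (hφ.differentiableAt (isOpen_ball.mem_nhds hu)).hasDerivAt
      rw [← funext hhφ, one_mul] at this
      exact this.deriv
    rw [e1.deriv_eq]
    have e2 := (hφ.differentiableAt hB).hasDerivAt.add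
      ((hasDerivAt_id (0 : ℂ)).mul ((hφ.deriv isOpen_ball).differentiableAt hB).hasDerivAt)
    refine e2.deriv.trans ?_
    simp
    ring
  rw [hdd, show 2 * deriv φ 0 = -4 * deriv s 0 by linear_combination 2 * hderiv, norm_mul]
  norm_num
  linarith

/-- The distortion estimate for the pre-Schwarzian derivative of a univalent function. -/
theorem norm_one_sub_sq_mul_deriv_deriv_div_sub_le_four {g : ℂ → ℂ}
    (hgd : DifferentiableOn ℂ g (ball 0 1)) (hginj : Set.InjOn g (ball 0 1)) {z : ℂ}
    (hz : z ∈ ball (0 : ℂ) 1) (hgz : deriv g z ≠ 0) :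
    ‖((1 - ‖z‖ ^ 2 : ℝ) : ℂ) * (deriv (deriv g) z / deriv g z) - 2 * starRingEnd ℂ z‖ ≤ 4 := by
  have hz1 : ‖z‖ < 1 := mem_ball_zero_iff.1 hz
  have hB : ball (0 : ℂ) 1 ∈ nhds 0 := ball_mem_nhds 0 one_pos
  set κ : ℂ := ((1 - ‖z‖ ^ 2 : ℝ) : ℂ) with hκ
  have hκz : z * starRingEnd ℂ z = 1 - κ := by
    rw [mul_conj, normSq_eq_norm_sq, hκ]; push_cast; ring
  have hκ0 : κ ≠ 0 := by
    rw [hκ, ofReal_ne_zero]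
    nlinarith [norm_nonneg z]
  set m : ℂ → ℂ := fun w ↦ (w + z) / (1 + starRingEnd ℂ z * w) with hm
  have hden : ∀ w ∈ ball (0 : ℂ) 1, 1 + starRingEnd ℂ z * w ≠ 0 := by
    intro w hw h
    have h2 : ‖starRingEnd ℂ z * w‖ = 1 := by
      rw [eq_neg_of_add_eq_zero_right h, norm_neg, norm_one]
    rw [norm_mul, norm_conj] at h2
    nlinarith [mem_ball_zero_iff.1 hw, norm_nonneg w, norm_nonneg z]
  have hmmem : ∀ w ∈ ball (0 : ℂ) 1, m w ∈ ball (0 : ℂ) 1 := by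
    intro w hw
    have hw1 : ‖w‖ < 1 := mem_ball_zero_iff.1 hw
    have hpos := norm_pos_iff.2 (hden w hw)
    rw [mem_ball_zero_iff, norm_div, div_lt_one hpos]
    refine lt_of_pow_lt_pow_left₀ 2 hpos.le ?_
    have hid : ‖1 + starRingEnd ℂ z * w‖ ^ 2 - ‖w + z‖ ^ 2 = (1 - ‖z‖ ^ 2) * (1 - ‖w‖ ^ 2) := by
      simp only [← normSq_eq_norm_sq, normSq_apply, add_re, add_im, mul_re, mul_im, conj_re,
        conj_im, one_re, one_im]
      ring
    have : 0 < (1 - ‖z‖ ^ 2) * (1 - ‖w‖ ^ 2) :=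
      mul_pos (by nlinarith [norm_nonneg z]) (by nlinarith [norm_nonneg w])
    linarith
  have hminj : Set.InjOn m (ball 0 1) := by
    intro w hw w' hw' heq
    simp only [hm] at heq
    rw [div_eq_div_iff (hden w hw) (hden w' hw')] at heq
    refine mul_left_cancel₀ hκ0 ?_
    linear_combination heq + (w - w') * hκz
  have hmd : ∀ w ∈ ball (0 : ℂ) 1, HasDerivAt m (κ / (1 + starRingEnd ℂ z * w) ^ 2) w := by
    intro w hw
    have e1 : HasDerivAt (fun w ↦ w + z) 1 w := (hasDerivAt_id w).add_const z
    have e2 : HasDerivAt (fun w ↦ 1 + starRingEnd ℂ z * w) (starRingEnd ℂ z) w := by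
      simpa using ((hasDerivAt_id w).const_mul (starRingEnd ℂ z)).const_add 1
    refine (e1.div e2 (hden w hw)).congr_deriv ?_
    congr 1
    linear_combination -hκz
  have hm0 : m 0 = z := by simp [hm]
  have hg' : ∀ w ∈ ball (0 : ℂ) 1, HasDerivAt g (deriv g w) w := fun w hw ↦
    (hgd.differentiableAt (isOpen_ball.mem_nhds hw)).hasDerivAt
  set h : ℂ → ℂ := fun w ↦ (g (m w) - g z) / (κ * deriv g z) with hh
  have hhd : ∀ w ∈ ball (0 : ℂ) 1, HasDerivAt h
      (deriv g (m w) * (κ / (1 + starRingEnd ℂ z * w) ^ 2) / (κ * deriv g z)) w := fun w hw ↦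
    (((hg' _ (hmmem w hw)).comp w (hmd w hw)).sub_const _).div_const _
  have hne : κ * deriv g z ≠ 0 := mul_ne_zero hκ0 hgz
  have hhinj : Set.InjOn h (ball 0 1) := by
    intro w hw w' hw' heq
    simp only [hh] at heq
    rw [div_left_inj' hne, sub_left_inj] at heq
    exact hminj hw hw' (hginj (hmmem w hw) (hmmem w' hw') heq)
  have hh1 : deriv h 0 = 1 := by
    rw [(hhd 0 (mem_ball_self one_pos)).deriv, hm0]
    field_simp
    simp
  have key := norm_deriv_deriv_zero_le_four
    (fun w hw ↦ (hhd w hw).differentiableAt.differentiableWithinAt) hhinj (by simp [hh, hm0]) hh1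
  have hdd : deriv (deriv h) 0 = κ * (deriv (deriv g) z / deriv g z) - 2 * starRingEnd ℂ z := by
    have e1 : deriv h =ᶠ[nhds 0] fun w ↦
        deriv g (m w) * (κ / (1 + starRingEnd ℂ z * w) ^ 2) / (κ * deriv g z) :=
      Filter.eventually_of_mem hB fun w hw ↦ (hhd w hw).deriv
    have e2 : HasDerivAt (fun w ↦ κ / (1 + starRingEnd ℂ z * w) ^ 2)
        (-2 * κ * starRingEnd ℂ z) 0 := by
      have e3 : HasDerivAt (fun w ↦ 1 + starRingEnd ℂ z * w) (starRingEnd ℂ z) 0 := by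
        simpa using ((hasDerivAt_id (0 : ℂ)).const_mul (starRingEnd ℂ z)).const_add 1
      refine ((hasDerivAt_const (0 : ℂ) κ).div (e3.pow 2) (by simp)).congr_deriv ?_
      simp
      ring
    have e4 : HasDerivAt (fun w ↦ deriv g (m w)) (deriv (deriv g) z * κ) 0 := by
      have e5 : HasDerivAt (deriv g) (deriv (deriv g) z) (m 0) := by
        rw [hm0]
        exact ((hgd.deriv isOpen_ball).differentiableAt (isOpen_ball.mem_nhds hz)).hasDerivAt
      exact (e5.comp 0 (hmd 0 (mem_ball_self one_pos))).congr_deriv (by simp)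
    rw [e1.deriv_eq]
    refine ((e4.mul e2).div_const _).deriv.trans ?_
    rw [hm0]
    field_simp
    simp
    ring
  rwa [hdd] at key

theorem stmt7 (α : ℝ) (hα0 : 0 ≤ α) (hα1 : α < 1)
    (f : ℂ → ℂ) (hfd : DifferentiableOn ℂ f (ball (0:ℂ) 1))
    (hf0 : f 0 = 0) (hf1 : deriv f 0 = 1)
    (hfne : ∀ z ∈ ball (0:ℂ) 1, z ≠ 0 → f z ≠ 0)
    (hstar : ∀ z ∈ ball (0:ℂ) 1, z ≠ 0 → α < (z * deriv f z / f z).re)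
    (g : ℂ → ℂ) (hgd : DifferentiableOn ℂ g (ball (0:ℂ) 1))
    (hg0 : g 0 = 0) (hg1 : deriv g 0 = 1)
    (hginj : Set.InjOn g (ball (0:ℂ) 1))
    (T : ℂ → ℂ) (hT : ∀ z ∈ ball (0:ℂ) 1, HasDerivAt T (f z * deriv g z) z) :
    ∀ z ∈ ball (0:ℂ) 1, ‖z‖ < (2 - Real.sqrt (3 + α^2)) / (1 - α) →
      0 < (1 + z * deriv (deriv T) z / deriv T z).re := by
  intro z hz hr
  rcases eq_or_ne z 0 with rfl | hz0
  · simp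
  rcases eq_or_ne (deriv g z) 0 with hgz | hgz
  · simp [(hT z hz).deriv, hgz]
  have hfz := hfne z hz hz0
  have hz1 : ‖z‖ < 1 := mem_ball_zero_iff.1 hz
  have hTdd : deriv (deriv T) z = deriv f z * deriv g z + f z * deriv (deriv g) z := by
    have e1 : deriv T =ᶠ[nhds z] fun w ↦ f w * deriv g w :=
      Filter.eventually_of_mem (isOpen_ball.mem_nhds hz) fun w hw ↦ (hT w hw).deriv
    rw [e1.deriv_eq]
    exact ((hfd.differentiableAt (isOpen_ball.mem_nhds hz)).hasDerivAt.mul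
      ((hgd.deriv isOpen_ball).differentiableAt (isOpen_ball.mem_nhds hz)).hasDerivAt).deriv
  have hsplit : 1 + z * deriv (deriv T) z / deriv T z =
      1 + z * deriv f z / f z + z * (deriv (deriv g) z / deriv g z) := by
    rw [hTdd, (hT z hz).deriv]
    field_simp
    ring
  set r := ‖z‖ with hrdef
  set p := deriv (deriv g) z / deriv g z with hp
  have hr0 : 0 ≤ r := norm_nonneg z
  have hr2 : 0 < 1 - r ^ 2 := by nlinarith
  have hdist : 2 * r ^ 2 - 4 * r ≤ (1 - r ^ 2) * (z * p).re := by
    have h1 := norm_one_sub_sq_mul_deriv_deriv_div_sub_le_four hgd hginj hz hgz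
    have h2 : ‖z * (((1 - r ^ 2 : ℝ) : ℂ) * p - 2 * starRingEnd ℂ z)‖ ≤ r * 4 := by
      rw [norm_mul]; exact mul_le_mul_of_nonneg_left h1 hr0
    have h3 : z * (((1 - r ^ 2 : ℝ) : ℂ) * p - 2 * starRingEnd ℂ z) =
        ((1 - r ^ 2 : ℝ) : ℂ) * (z * p) - (2 * r ^ 2 : ℝ) := by
      have := mul_conj z
      rw [normSq_eq_norm_sq, ← hrdef] at this
      push_cast at this ⊢
      linear_combination -2 * this
    have h4 := (abs_le.1 ((abs_re_le_norm _).trans h2)).1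
    rw [h3, sub_re, re_ofReal_mul, ofReal_re] at h4
    linarith
  have hpoly : 0 < 1 + α - 4 * r + (1 - α) * r ^ 2 := by
    have hα : 0 < 1 - α := sub_pos.2 hα1
    rw [lt_div_iff₀ hα] at hr
    have h1 : Real.sqrt (3 + α ^ 2) < 2 - (1 - α) * r := by linarith
    have h2 := (Real.sqrt_lt' ((Real.sqrt_nonneg _).trans_lt h1)).1 h1
    refine pos_of_mul_pos_right ?_ hα.le
    nlinarith
  have hs := hstar z hz hz0
  rw [hsplit, add_re, add_re, one_re]
  refine pos_of_mul_pos_right (a := 1 - r ^ 2) ?_ hr2.le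
  nlinarith [mul_pos hr2 (sub_pos.2 hs)]
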